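/- arXiv:1712.04068 — 2 statements merged into one kernel-verified Lean document; each statement's English description precedes it below -/
import Mathlib

section
/- Let β, m ∈ ℂ with 2m ∉ ℤ. Then the Wronskian of ℐ_{β,m} and 𝒦_{β,m} is constant on (0,∞) and equals −1/Γ(1/2+m−β): for every x > 0, ℐ_{β,m}(x)·𝒦_{β,m}'(x) − ℐ_{β,m}'(x)·𝒦_{β,m}(x) = −1/Γ(1/2+m−β). -/
/-- Pochhammer symbol `(a)_k = a (a+1) ⋯ (a+k-1)`. -/
noncomputable def poch (a : ℂ) (k : ℕ) : ℂ := ∏ i ∈ Finset.range k, (a + i)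

/-- Regularized confluent hypergeometric function
`₁𝐅₁(a;c;z) = Σ_{k=0}^∞ (a)_k z^k / (Γ(c+k)·k!)`. -/
noncomputable def regF1 (a c z : ℂ) : ℂ :=
  ∑' k : ℕ, poch a k * z ^ k / (Complex.Gamma (c + k) * (Nat.factorial k))

/-- The Whittaker-type function `ℐ_{β,m}(z) = z^{1/2+m} e^{-z/2} ₁𝐅₁(1/2+m-β; 1+2m; z)`. -/
noncomputable def WI (β m z : ℂ) : ℂ :=
  z ^ ((1 : ℂ) / 2 + m) * Complex.exp (-z / 2) * regF1 (1 / 2 + m - β) (1 + 2 * m) z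

/-- For `2m ∉ ℤ`, the Whittaker function
`𝒦_{β,m}(z) = −(π/sin(2πm)) (ℐ_{β,m}(z)/Γ(1/2−m−β) − ℐ_{β,−m}(z)/Γ(1/2+m−β))`. -/
noncomputable def WK (β m z : ℂ) : ℂ :=
  -((Real.pi : ℂ) / Complex.sin (2 * (Real.pi : ℂ) * m)) *
    (WI β m z / Complex.Gamma (1 / 2 - m - β) - WI β (-m) z / Complex.Gamma (1 / 2 + m - β))

/-- An everywhere convergent power series may be differentiated term by term. -/
theorem hasDerivAt_tsum_mul_pow {u : ℕ → ℂ} (hu : ∀ z : ℂ, Summable fun k => u k * z ^ k) :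
    (∀ z : ℂ, Summable fun k : ℕ => ((k : ℂ) + 1) * u (k + 1) * z ^ k) ∧
      ∀ z : ℂ, HasDerivAt (fun w => ∑' k : ℕ, u k * w ^ k)
        (∑' k : ℕ, ((k : ℂ) + 1) * u (k + 1) * z ^ k) z := by
  have hbound : ∀ R : ℝ, 0 < R → Summable fun k : ℕ => ‖u k‖ * (k * R ^ (k - 1)) := by
    intro R hR
    have h := ((hu (2 * R : ℝ)).norm).mul_left R⁻¹
    refine Summable.of_nonneg_of_le (fun k => by positivity) (fun k => ?_) h
    have hk : (k : ℝ) ≤ 2 ^ k := by exact_mod_cast Nat.lt_two_pow_self.le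
    rcases k with _ | k
    · simp; positivity
    · rw [norm_mul, norm_pow, Complex.norm_real, Real.norm_of_nonneg (by positivity), mul_pow,
        Nat.add_sub_cancel]
      calc ‖u (k + 1)‖ * (((k + 1 : ℕ) : ℝ) * R ^ k)
          ≤ ‖u (k + 1)‖ * (2 ^ (k + 1) * R ^ k) := by gcongr
        _ = R⁻¹ * (‖u (k + 1)‖ * (2 ^ (k + 1) * R ^ (k + 1))) := by field_simp; ring
  have hterm : ∀ (R : ℝ) (z : ℂ), ‖z‖ ≤ R → ∀ k : ℕ,
      ‖u k * ((k : ℂ) * z ^ (k - 1))‖ ≤ ‖u k‖ * (k * R ^ (k - 1)) := by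
    intro R z hz k
    rw [norm_mul, norm_mul, norm_pow, Complex.norm_natCast]
    gcongr
  have hpos : ∀ z : ℂ, 0 < ‖z‖ + 1 := fun z => by positivity
  have hsum : ∀ z : ℂ, Summable fun k : ℕ => u k * ((k : ℂ) * z ^ (k - 1)) := fun z =>
    Summable.of_norm_bounded (hbound _ (hpos z)) (hterm _ z (by linarith))
  have heq : ∀ (z : ℂ) (k : ℕ), u (k + 1) * (((k + 1 : ℕ) : ℂ) * z ^ (k + 1 - 1)) =
      ((k : ℂ) + 1) * u (k + 1) * z ^ k := by
    intro z k
    rw [Nat.add_sub_cancel]; push_cast; ring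
  refine ⟨fun z => ?_, fun z => ?_⟩
  · simpa only [heq] using (summable_nat_add_iff 1).2 (hsum z)
  · have hz : z ∈ Metric.ball (0 : ℂ) (‖z‖ + 1) := by simp
    have h := hasDerivAt_tsum_of_isPreconnected (hbound _ (hpos z)) Metric.isOpen_ball
      (convex_ball (0 : ℂ) (‖z‖ + 1)).isPreconnected
      (fun k y _ => (hasDerivAt_pow k y).const_mul (u k))
      (fun k y hy => hterm _ y (mem_ball_zero_iff.1 hy).le k) hz (hu z) hz
    rw [(hsum z).tsum_eq_zero_add] at h
    simpa only [heq, Nat.cast_zero, zero_mul, mul_zero, zero_add] using h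

theorem hasSum_nat_mul_mul_pow {u : ℕ → ℂ} (hu : ∀ z : ℂ, Summable fun k => u k * z ^ k) (z : ℂ) :
    HasSum (fun k : ℕ => (k : ℂ) * u k * z ^ k)
      (z * ∑' k : ℕ, ((k : ℂ) + 1) * u (k + 1) * z ^ k) := by
  rw [← hasSum_nat_add_iff' 1]
  have h := (((hasDerivAt_tsum_mul_pow hu).1 z).hasSum).mul_left z
  simp only [Finset.range_one, Finset.sum_singleton, Nat.cast_zero, zero_mul, sub_zero]
  refine h.congr_fun ?_
  intro k
  push_cast
  ring

/-- The `k`-th Taylor coefficient of `regF1 a c`. -/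
noncomputable def regF1Coeff (a c : ℂ) (k : ℕ) : ℂ :=
  poch a k / (Complex.Gamma (c + k) * (Nat.factorial k))

theorem regF1_eq_tsum (a c z : ℂ) : regF1 a c z = ∑' k : ℕ, regF1Coeff a c k * z ^ k := by
  simp only [regF1, regF1Coeff, div_mul_eq_mul_div]

theorem regF1Coeff_succ (a c : ℂ) (k : ℕ) :
    (c + k) * (((k : ℂ) + 1) * regF1Coeff a c (k + 1)) = (a + k) * regF1Coeff a c k := by
  have hk : (k : ℂ) + 1 ≠ 0 := Nat.cast_add_one_ne_zero k
  have hf : (Nat.factorial k : ℂ) ≠ 0 := by exact_mod_cast Nat.factorial_ne_zero k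
  have h := Complex.one_div_Gamma_eq_self_mul_one_div_Gamma_add_one (c + k)
  simp only [regF1Coeff, poch, Finset.prod_range_succ, Nat.factorial_succ, div_eq_mul_inv, mul_inv]
  push_cast
  rw [h, add_assoc c]
  field_simp

open Filter Topology in
theorem summable_regF1Coeff_mul_pow (a c z : ℂ) : Summable fun k => regF1Coeff a c k * z ^ k := by
  have hratio : Tendsto (fun k : ℕ => (a + k) / (c + k) * (z / ((k : ℂ) + 1))) atTop (𝓝 0) := by
    have h := (tendsto_add_mul_div_add_mul_atTop_nhds a c (1 : ℂ) one_ne_zero).mul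
      (tendsto_add_mul_div_add_mul_atTop_nhds z 1 (0 : ℂ) one_ne_zero)
    simpa [add_comm (1 : ℂ)] using h
  have hne : ∀ᶠ k : ℕ in atTop, c + k ≠ 0 := by
    obtain ⟨N, hN⟩ := exists_nat_gt ‖c‖
    filter_upwards [eventually_ge_atTop N] with k hk h
    have hck : ‖c‖ = k := by rw [eq_neg_of_add_eq_zero_left h, norm_neg, Complex.norm_natCast]
    have : (N : ℝ) ≤ k := by exact_mod_cast hk
    linarith
  have hsmall := hratio.norm.eventually_le_const (show ‖(0 : ℂ)‖ < 1 / 2 by simp)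
  refine summable_of_ratio_norm_eventually_le (r := 1 / 2) (by norm_num) ?_
  filter_upwards [hsmall, hne] with k hk hck
  have hk1 : (k : ℂ) + 1 ≠ 0 := Nat.cast_add_one_ne_zero k
  have hstep : regF1Coeff a c (k + 1) * z ^ (k + 1) =
      (a + k) / (c + k) * (z / ((k : ℂ) + 1)) * (regF1Coeff a c k * z ^ k) := by
    field_simp
    linear_combination z ^ (k + 1) * regF1Coeff_succ a c k
  rw [hstep, norm_mul]
  gcongr

theorem hasDerivAt_regF1 (a c z : ℂ) :
    HasDerivAt (regF1 a c) (∑' k : ℕ, ((k : ℂ) + 1) * regF1Coeff a c (k + 1) * z ^ k) z := by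
  rw [funext (regF1_eq_tsum a c)]
  exact (hasDerivAt_tsum_mul_pow (summable_regF1Coeff_mul_pow a c)).2 z

/-- Kummer's differential equation for the regularized confluent hypergeometric function. -/
theorem exists_hasDerivAt_deriv_regF1 (a c z : ℂ) :
    ∃ F'' : ℂ, HasDerivAt (deriv (regF1 a c)) F'' z ∧
      z * F'' + (c - z) * deriv (regF1 a c) z - a * regF1 a c z = 0 := by
  have hu := summable_regF1Coeff_mul_pow a c
  have hw := (hasDerivAt_tsum_mul_pow hu).1
  have hderiv : deriv (regF1 a c) =
      fun z => ∑' k : ℕ, ((k : ℂ) + 1) * regF1Coeff a c (k + 1) * z ^ k :=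
    funext fun z => (hasDerivAt_regF1 a c z).deriv
  rw [hderiv]
  refine ⟨_, (hasDerivAt_tsum_mul_pow hw).2 z, ?_⟩
  have h := (((hasSum_nat_mul_mul_pow hw z).add ((hw z).hasSum.mul_left c)).sub
    (hasSum_nat_mul_mul_pow hu z)).sub ((hu z).hasSum.mul_left a)
  have h0 := h.congr_fun (g := fun _ => 0) fun k => by
    linear_combination -z ^ k * regF1Coeff_succ a c k
  have := h0.unique hasSum_zero
  rw [regF1_eq_tsum]
  linear_combination this

theorem regF1_zero (a c : ℂ) : regF1 a c 0 = 1 / Complex.Gamma c := by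
  rw [regF1, tsum_eq_single 0 fun k hk => by simp [hk]]
  simp [poch]

/-- The Wronskian identity for the two Kummer solutions at the origin. -/
theorem regF1_wronskian (β m z : ℂ) (hm : ∀ n : ℤ, 2 * m ≠ (n : ℂ)) :
    z * (regF1 (1 / 2 + m - β) (1 + 2 * m) z * deriv (regF1 (1 / 2 - m - β) (1 - 2 * m)) z -
        deriv (regF1 (1 / 2 + m - β) (1 + 2 * m)) z * regF1 (1 / 2 - m - β) (1 - 2 * m) z) -
      2 * m * (regF1 (1 / 2 + m - β) (1 + 2 * m) z * regF1 (1 / 2 - m - β) (1 - 2 * m) z) =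
    -(Complex.sin (2 * Real.pi * m) / Real.pi) * Complex.exp z := by
  set F := regF1 (1 / 2 + m - β) (1 + 2 * m) with hF
  set G := regF1 (1 / 2 - m - β) (1 - 2 * m) with hG
  let W : ℂ → ℂ := fun z => Complex.exp (-z) *
    (z * (F z * deriv G z - deriv F z * G z) - 2 * m * (F z * G z))
  have hW : ∀ z, HasDerivAt W 0 z := by
    intro z
    obtain ⟨F'', hF'', hFode⟩ := exists_hasDerivAt_deriv_regF1 (1 / 2 + m - β) (1 + 2 * m) z
    obtain ⟨G'', hG'', hGode⟩ := exists_hasDerivAt_deriv_regF1 (1 / 2 - m - β) (1 - 2 * m) z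
    have hF' : HasDerivAt F (deriv F z) z := (hasDerivAt_regF1 _ _ z).differentiableAt.hasDerivAt
    have hG' : HasDerivAt G (deriv G z) z := (hasDerivAt_regF1 _ _ z).differentiableAt.hasDerivAt
    rw [← hF] at hF'' hFode
    rw [← hG] at hG'' hGode
    have h := ((hasDerivAt_id z).neg.cexp).mul
      (((hasDerivAt_id z).mul ((hF'.mul hG'').sub (hF''.mul hG'))).sub
        ((hF'.mul hG').const_mul (2 * m)))
    refine h.congr_deriv ?_
    simp only [Pi.mul_apply, Pi.sub_apply, Pi.neg_apply, id]
    linear_combination Complex.exp (-z) * (F z * hGode - G z * hFode)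
  have hconst : W z = W 0 :=
    is_const_of_deriv_eq_zero (fun z => (hW z).differentiableAt) (fun z => (hW z).deriv) z 0
  have hW0 : W 0 = -(Complex.sin (2 * Real.pi * m) / Real.pi) := by
    have h2m : 2 * m ≠ 0 := by simpa using hm 0
    have hm0 : m ≠ 0 := right_ne_zero_of_mul h2m
    have hrefl := Complex.Gamma_mul_Gamma_one_sub (2 * m)
    simp only [W, hF, hG, regF1_zero, neg_zero, Complex.exp_zero, zero_mul, one_mul, zero_sub]
    rw [add_comm 1, Complex.Gamma_add_one _ h2m]
    calc -(2 * m * (1 / (2 * m * Complex.Gamma (2 * m)) * (1 / Complex.Gamma (1 - 2 * m))))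
        = -(Complex.Gamma (2 * m) * Complex.Gamma (1 - 2 * m))⁻¹ := by
          rw [mul_inv]; field_simp
      _ = _ := by rw [hrefl, inv_div]; ring_nf
  rw [hW0] at hconst
  rw [← hconst]
  have hexp : Complex.exp (-z) * Complex.exp z = 1 := by
    rw [← Complex.exp_add, neg_add_cancel, Complex.exp_zero]
  simp only [W]
  linear_combination -(z * (F z * deriv G z - deriv F z * G z) - 2 * m * (F z * G z)) * hexp

theorem hasDerivAt_WI (β m : ℂ) {x : ℝ} (hx : 0 < x) :
    HasDerivAt (fun t : ℝ => WI β m t)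
      ((x : ℂ) ^ ((1 : ℂ) / 2 + m) * Complex.exp (-x / 2) *
        (((1 / 2 + m) / x - 1 / 2) * regF1 (1 / 2 + m - β) (1 + 2 * m) x +
          deriv (regF1 (1 / 2 + m - β) (1 + 2 * m)) x)) x := by
  have hx0 : (x : ℂ) ≠ 0 := by exact_mod_cast hx.ne'
  have hF := (hasDerivAt_regF1 (1 / 2 + m - β) (1 + 2 * m) x).differentiableAt.hasDerivAt
  have hp := (hasDerivAt_id (x : ℂ)).cpow_const (c := 1 / 2 + m) (Complex.ofReal_mem_slitPlane.2 hx)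
  have he := (((hasDerivAt_id (x : ℂ)).neg).div_const 2).cexp
  refine ((hp.mul he).mul hF).comp_ofReal.congr_deriv ?_
  simp only [Pi.mul_apply, Pi.neg_apply, id, Complex.cpow_sub _ _ hx0, Complex.cpow_one]
  field_simp
  ring

/-- For `2m ∉ ℤ`, the Wronskian of `ℐ_{β,m}` and `𝒦_{β,m}` equals `−1/Γ(1/2+m−β)`
at every `x > 0`. -/
theorem wronskian_WI_WK (β m : ℂ) (hm : ∀ n : ℤ, 2 * m ≠ (n : ℂ)) :
    ∀ x : ℝ, 0 < x →
      WI β m (x : ℂ) * deriv (fun t : ℝ => WK β m (t : ℂ)) x -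
        deriv (fun t : ℝ => WI β m (t : ℂ)) x * WK β m (x : ℂ) =
      -1 / Complex.Gamma (1 / 2 + m - β) := by
  intro x hx
  have hx0 : (x : ℂ) ≠ 0 := by exact_mod_cast hx.ne'
  have hpi : (Real.pi : ℂ) ≠ 0 := by exact_mod_cast Real.pi_ne_zero
  have hsin : Complex.sin (2 * Real.pi * m) ≠ 0 := by
    rw [Complex.sin_ne_zero_iff]
    intro k hk
    exact hm k (mul_right_cancel₀ hpi (by linear_combination hk))
  have hI := hasDerivAt_WI β m hx
  have hJ := hasDerivAt_WI β (-m) hx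
  have hK : HasDerivAt (fun t : ℝ => WK β m t) _ x :=
    ((hI.div_const (Complex.Gamma (1 / 2 - m - β))).sub
      (hJ.div_const (Complex.Gamma (1 / 2 + m - β)))).const_mul
        (-((Real.pi : ℂ) / Complex.sin (2 * Real.pi * m)))
  have hpow : (x : ℂ) ^ ((1 : ℂ) / 2 + m) * (x : ℂ) ^ ((1 : ℂ) / 2 + -m) = x := by
    rw [← Complex.cpow_add _ _ hx0]
    ring_nf
    exact Complex.cpow_one _
  have hexp : Complex.exp (-x / 2) * Complex.exp (-x / 2) * Complex.exp x = 1 := by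
    rw [← Complex.exp_add, ← Complex.exp_add]
    ring_nf
    exact Complex.exp_zero
  have hW := regF1_wronskian β m x hm
  have hm1 : (1 : ℂ) / 2 + -m - β = 1 / 2 - m - β := by ring
  have hm2 : (1 : ℂ) + 2 * -m = 1 - 2 * m := by ring
  rw [hm1, hm2] at hJ hK
  rw [hI.deriv, hK.deriv]
  simp only [WK, WI, hm1, hm2]
  set F := regF1 (1 / 2 + m - β) (1 + 2 * m)
  set G := regF1 (1 / 2 - m - β) (1 - 2 * m)
  set p := (x : ℂ) ^ ((1 : ℂ) / 2 + m)
  set q := (x : ℂ) ^ ((1 : ℂ) / 2 + -m)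
  set e := Complex.exp (-(x : ℂ) / 2)
  set s := Complex.sin (2 * Real.pi * m)
  have key : p * e * F x * (q * e * (((1 / 2 + -m) / x - 1 / 2) * G x + deriv G x)) -
      p * e * (((1 / 2 + m) / x - 1 / 2) * F x + deriv F x) * (q * e * G x) = -(s / Real.pi) := by
    calc _ = (p * q / x) * (e * e) * (x * (F x * deriv G x - deriv F x * G x)
          - 2 * m * (F x * G x)) := by field_simp; ring
      _ = -(s / Real.pi) * (e * e * Complex.exp x) := by
          rw [hW, hpow, div_self hx0]; ring
      _ = _ := by rw [hexp, mul_one]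
  have hone : (Real.pi : ℂ) / s * (s / Real.pi) = 1 := by field_simp
  linear_combination (Real.pi : ℂ) / s / Complex.Gamma (1 / 2 + m - β) * key -
    hone / Complex.Gamma (1 / 2 + m - β)
end

section
/- Let m ∈ ℂ with 2m ∉ ℤ and β ∈ ℂ∖(−∞,0]. Define j_{β,m}(x) := x^{1/4}·𝒥_{2m}(2√(βx)) and y_{β,m}(x) := x^{1/4}·𝒴_{2m}(2√(βx)) for x > 0, using the principal square root. Then the Wronskian of j_{β,m} and y_{β,m} is constant on (0,∞) and equals √β: for every x > 0, j_{β,m}(x)·y_{β,m}'(x) − j_{β,m}'(x)·y_{β,m}(x) = √β. -/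
/-- The Bessel function `J_ν(z) = Σ_{k=0}^∞ (−1)^k (z/2)^{ν+2k} / (k! Γ(ν+k+1))`,
with principal branch powers. -/
noncomputable def besselJ (ν z : ℂ) : ℂ :=
  ∑' k : ℕ, (-1) ^ k * (z / 2) ^ (ν + 2 * (k : ℂ)) /
    ((Nat.factorial k : ℂ) * Complex.Gamma (ν + k + 1))

/-- The Bessel function for dimension 1: `𝒥_ν(z) = √(πz/2) · J_ν(z)`. -/
noncomputable def calJ (ν z : ℂ) : ℂ :=
  ((Real.pi : ℂ) * z / 2) ^ ((1 : ℂ) / 2) * besselJ ν z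

/-- The Neumann function `Y_ν(z) = (cos(νπ) J_ν(z) − J_{−ν}(z)) / sin(νπ)` for `ν ∉ ℤ`. -/
noncomputable def besselY (ν z : ℂ) : ℂ :=
  (Complex.cos (ν * (Real.pi : ℂ)) * besselJ ν z - besselJ (-ν) z) /
    Complex.sin (ν * (Real.pi : ℂ))

/-- The Neumann function for dimension 1: `𝒴_ν(z) = √(πz/2) · Y_ν(z)`. -/
noncomputable def calY (ν z : ℂ) : ℂ :=
  ((Real.pi : ℂ) * z / 2) ^ ((1 : ℂ) / 2) * besselY ν z

/-- The zero-energy solution `j_{β,m}(x) = x^{1/4} 𝒥_{2m}(2√(βx))`. -/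
noncomputable def jfun (β m : ℂ) (x : ℝ) : ℂ :=
  (x : ℂ) ^ ((1 : ℂ) / 4) * calJ (2 * m) (2 * (β * x) ^ ((1 : ℂ) / 2))

/-- The zero-energy solution `y_{β,m}(x) = x^{1/4} 𝒴_{2m}(2√(βx))`. -/
noncomputable def yfun (β m : ℂ) (x : ℝ) : ℂ :=
  (x : ℂ) ^ ((1 : ℂ) / 4) * calY (2 * m) (2 * (β * x) ^ ((1 : ℂ) / 2))

/-- The regularized confluent hypergeometric limit function `Σ zⁿ / (n! Γ(b+n))`. -/
noncomputable def bessel01 (b z : ℂ) : ℂ :=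
  ∑' n : ℕ, (1 / ((Nat.factorial n : ℂ) * Complex.Gamma (b + n))) * z ^ n

lemma summable_norm_bessel01 (b z : ℂ) :
    Summable fun n : ℕ =>
      ‖(1 / ((Nat.factorial n : ℂ) * Complex.Gamma (b + n))) * z ^ n‖ := by
  have hr := Complex.radius_regularizedHGFunSeries_eq_top (a := 0) (b := {b}) (by simp)
  have h := (Complex.regularizedHGFunSeries 0 {b}).summable_norm_apply (x := z) (by simp [hr])
  refine h.congr fun n => ?_
  simp [Complex.regularizedHGFunSeries, Complex.regularizedHGFunCoeff, mul_comm (‖z‖ ^ n)]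

lemma summable_bessel01 (b z : ℂ) :
    Summable fun n : ℕ =>
      (1 / ((Nat.factorial n : ℂ) * Complex.Gamma (b + n))) * z ^ n :=
  (summable_norm_bessel01 b z).of_norm

lemma bessel01_zero (b : ℂ) : bessel01 b 0 = 1 / Complex.Gamma b := by
  rw [bessel01, tsum_eq_single 0 (by intro n hn; simp [hn])]
  simp

lemma bessel01_deriv_coeff (b : ℂ) (n : ℕ) :
    1 / ((Nat.factorial (n + 1) : ℂ) * Complex.Gamma (b + (n + 1 : ℕ))) * ((n + 1 : ℕ) : ℂ) =
      1 / ((Nat.factorial n : ℂ) * Complex.Gamma (b + 1 + n)) := by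
  have h : b + 1 + (n : ℂ) = b + (n + 1 : ℕ) := by push_cast; ring
  have h1 : ((n + 1 : ℕ) : ℂ) ≠ 0 := by exact_mod_cast Nat.succ_ne_zero n
  rw [h, Nat.factorial_succ, Nat.cast_mul, one_div, one_div, mul_inv, mul_inv, mul_inv]
  field_simp

lemma hasDerivAt_bessel01 (b z : ℂ) : HasDerivAt (bessel01 b) (bessel01 (b + 1) z) z := by
  set R : ℝ := ‖z‖ + 1 with hR
  have hzR : z ∈ Metric.ball (0 : ℂ) R := by simp [hR]
  have hR0 : 0 ≤ R := by positivity
  let g' : ℕ → ℂ → ℂ := fun n y =>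
    1 / ((Nat.factorial n : ℂ) * Complex.Gamma (b + n)) * (n * y ^ (n - 1))
  have hg'succ : ∀ (n : ℕ) (y : ℂ), g' (n + 1) y =
      1 / ((Nat.factorial n : ℂ) * Complex.Gamma (b + 1 + n)) * y ^ n := by
    intro n y
    rw [← bessel01_deriv_coeff]
    simp only [g', Nat.add_sub_cancel]
    ring
  have hsum : Summable fun n => ‖g' n R‖ := by
    rw [← summable_nat_add_iff 1]
    exact (summable_norm_bessel01 (b + 1) R).congr fun n => by rw [hg'succ]
  have key := hasDerivAt_tsum_of_isPreconnected (𝕜 := ℂ) (u := fun n => ‖g' n R‖)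
    (g := fun n y => 1 / ((Nat.factorial n : ℂ) * Complex.Gamma (b + n)) * y ^ n) (g' := g')
    (y := z) hsum Metric.isOpen_ball (convex_ball (0 : ℂ) R).isPreconnected
    (fun n y _ => (hasDerivAt_pow n y).const_mul _) (fun n y hy => ?_) hzR
    (summable_bessel01 b z) hzR
  · have hs : Summable fun n => g' n z := by
      rw [← summable_nat_add_iff 1]
      exact (summable_bessel01 (b + 1) z).congr fun n => by rw [hg'succ]
    rw [hs.tsum_eq_zero_add] at key
    simp only [hg'succ] at key
    have h0 : g' 0 z = 0 := by simp [g']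
    rw [h0, zero_add] at key
    exact key
  · have hy' : ‖y‖ ≤ R := by simpa using (Metric.mem_ball.mp hy).le
    simp only [g', norm_mul, norm_pow, Complex.norm_real, Real.norm_of_nonneg hR0]
    gcongr

/-- The contiguous relation for the regularized `₀F₁`. -/
lemma bessel01_contiguous (b z : ℂ) :
    bessel01 b z = b * bessel01 (b + 1) z + z * bessel01 (b + 2) z := by
  have hs : Summable fun n : ℕ =>
      (n : ℂ) * (1 / ((Nat.factorial n : ℂ) * Complex.Gamma (b + 1 + n)) * z ^ n) := by
    rw [← summable_nat_add_iff 1]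
    refine ((summable_bessel01 (b + 1 + 1) z).mul_left z).congr fun n => ?_
    rw [← bessel01_deriv_coeff]
    ring
  have h2 : z * bessel01 (b + 2) z = ∑' n : ℕ,
      (n : ℂ) * (1 / ((Nat.factorial n : ℂ) * Complex.Gamma (b + 1 + n)) * z ^ n) := by
    rw [hs.tsum_eq_zero_add, bessel01, ← tsum_mul_left]
    simp only [Nat.cast_zero, zero_mul, zero_add]
    refine tsum_congr fun n => ?_
    rw [show b + 2 = b + 1 + 1 by ring, ← bessel01_deriv_coeff]
    ring
  rw [h2, bessel01, bessel01, ← tsum_mul_left,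
    ← ((summable_bessel01 (b + 1) z).mul_left b).tsum_add hs]
  refine tsum_congr fun n => ?_
  have h := Complex.one_div_Gamma_eq_self_mul_one_div_Gamma_add_one (b + n)
  rw [one_div, one_div, mul_inv, mul_inv, h, show b + 1 + (n : ℂ) = b + n + 1 by ring]
  ring

/-- The Wronskian identity for the two solutions of the `₀F₁` equation at `ν` and `-ν`. -/
lemma bessel01_wronskian (ν z : ℂ) :
    z * (bessel01 (ν + 1) z * bessel01 (-ν + 2) z - bessel01 (ν + 2) z * bessel01 (-ν + 1) z)
      - ν * (bessel01 (ν + 1) z * bessel01 (-ν + 1) z) =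
    -ν * (1 / Complex.Gamma (ν + 1) * (1 / Complex.Gamma (-ν + 1))) := by
  have hd : ∀ μ y : ℂ, HasDerivAt (bessel01 (μ + 1)) (bessel01 (μ + 2) y) y := fun μ y => by
    have := hasDerivAt_bessel01 (μ + 1) y
    rwa [show μ + 1 + 1 = μ + 2 by ring] at this
  have hd2 : ∀ μ y : ℂ, HasDerivAt (bessel01 (μ + 2)) (bessel01 (μ + 3) y) y := fun μ y => by
    have := hasDerivAt_bessel01 (μ + 2) y
    rwa [show μ + 2 + 1 = μ + 3 by ring] at this
  have hc : ∀ μ y : ℂ, bessel01 (μ + 1) y =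
      (μ + 1) * bessel01 (μ + 2) y + y * bessel01 (μ + 3) y := fun μ y => by
    have := bessel01_contiguous (μ + 1) y
    rwa [show μ + 1 + 1 = μ + 2 by ring, show μ + 1 + 2 = μ + 3 by ring] at this
  have hH : ∀ y : ℂ, HasDerivAt (fun z => z * (bessel01 (ν + 1) z * bessel01 (-ν + 2) z -
      bessel01 (ν + 2) z * bessel01 (-ν + 1) z)
      - ν * (bessel01 (ν + 1) z * bessel01 (-ν + 1) z)) 0 y := fun y => by
    have h := ((hasDerivAt_id y).mul (((hd ν y).mul (hd2 (-ν) y)).sub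
      ((hd2 ν y).mul (hd (-ν) y)))).sub (((hd ν y).mul (hd (-ν) y)).const_mul ν)
    refine h.congr_deriv ?_
    simp only [id, Pi.mul_apply, Pi.sub_apply]
    linear_combination (bessel01 (ν + 1) y) * (-hc (-ν) y) + (bessel01 (-ν + 1) y) * (hc ν y)
  have := is_const_of_deriv_eq_zero (fun y => (hH y).differentiableAt) (fun y => (hH y).deriv) z 0
  simpa [bessel01_zero] using this

lemma Complex.mul_one_div_Gamma_mul_one_div_Gamma {ν : ℂ} (hν : ν ≠ 0) :
    ν * (1 / Complex.Gamma (ν + 1) * (1 / Complex.Gamma (-ν + 1))) =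
      Complex.sin (ν * Real.pi) / Real.pi := by
  have h := Complex.Gamma_mul_Gamma_one_sub ν
  rw [Complex.Gamma_add_one ν hν, mul_comm ν (Real.pi : ℂ), ← inv_div (Real.pi : ℂ), ← h,
    show -ν + 1 = 1 - ν by ring, one_div, one_div, mul_inv, mul_inv, ← mul_assoc, ← mul_assoc,
    mul_inv_cancel₀ hν, one_mul]

/-- Multiplication by a positive real is compatible with principal branch powers. -/
lemma Complex.ofReal_mul_cpow_of_pos {r : ℝ} (hr : 0 < r) {w : ℂ} (hw : w ≠ 0) (s : ℂ) :
    ((r : ℂ) * w) ^ s = (r : ℂ) ^ s * w ^ s := by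
  have hr' : (r : ℂ) ≠ 0 := by exact_mod_cast hr.ne'
  rw [Complex.cpow_def_of_ne_zero (mul_ne_zero hr' hw), Complex.cpow_def_of_ne_zero hr',
    Complex.cpow_def_of_ne_zero hw, ← Complex.exp_add, Complex.log_ofReal_mul hr hw,
    Complex.ofReal_log hr.le]
  ring_nf

/-- Powers of the principal square root. -/
lemma Complex.cpow_half_cpow (w s : ℂ) : (w ^ ((1 : ℂ) / 2)) ^ s = w ^ (s / 2) := by
  have him : (Complex.log w * (1 / 2)).im = Complex.arg w / 2 := by
    rw [show (1 / 2 : ℂ) = ((1 / 2 : ℝ) : ℂ) by push_cast; rfl, Complex.im_mul_ofReal,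
      Complex.log_im]
    ring
  rw [← Complex.cpow_mul]
  · congr 1; ring
  · rw [him]; linarith [Complex.neg_pi_lt_arg w, Real.pi_pos]
  · rw [him]; linarith [Complex.arg_le_pi w, Real.pi_pos]

lemma besselJ_two_mul_sqrt (ν : ℂ) {w : ℂ} (hw : w ≠ 0) :
    besselJ ν (2 * w ^ ((1 : ℂ) / 2)) = w ^ (ν / 2) * bessel01 (ν + 1) (-w) := by
  rw [besselJ, bessel01, ← tsum_mul_left]
  refine tsum_congr fun k => ?_
  rw [mul_div_cancel_left₀ _ (two_ne_zero' ℂ), Complex.cpow_half_cpow,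
    show (ν + 2 * (k : ℂ)) / 2 = ν / 2 + k by ring, Complex.cpow_add _ _ hw, Complex.cpow_natCast,
    neg_pow w, show ν + (k : ℂ) + 1 = ν + 1 + k by ring]
  ring

lemma jfun_eq (m : ℂ) {β : ℂ} (hβ : β ≠ 0) {x : ℝ} (hx : 0 < x) :
    jfun β m x = ((Real.pi : ℂ) ^ ((1 : ℂ) / 2) * β ^ ((1 : ℂ) / 4) * β ^ m) *
      ((x : ℂ) ^ (1 / 2 + m) * bessel01 (2 * m + 1) (-β * x)) := by
  have hx' : (x : ℂ) ≠ 0 := by exact_mod_cast hx.ne'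
  have hw : β * x ≠ 0 := mul_ne_zero hβ hx'
  have hpow : ∀ s : ℂ, (β * x) ^ s = (x : ℂ) ^ s * β ^ s := fun s => by
    rw [mul_comm, Complex.ofReal_mul_cpow_of_pos hx hβ]
  have hs : (β * x) ^ ((1 : ℂ) / 2) ≠ 0 := by simp [Complex.cpow_eq_zero_iff, hw]
  rw [jfun, calJ, besselJ_two_mul_sqrt _ hw,
    show (Real.pi : ℂ) * (2 * (β * x) ^ ((1 : ℂ) / 2)) / 2 = Real.pi * (β * x) ^ ((1 : ℂ) / 2) by
      ring, Complex.ofReal_mul_cpow_of_pos Real.pi_pos hs, Complex.cpow_half_cpow, hpow, hpow,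
    show (1 : ℂ) / 2 / 2 = 1 / 4 by norm_num, mul_div_cancel_left₀ _ (two_ne_zero' ℂ),
    show (1 : ℂ) / 2 + m = 1 / 4 + 1 / 4 + m by ring, Complex.cpow_add _ _ hx',
    Complex.cpow_add _ _ hx', neg_mul]
  ring

lemma yfun_eq (β m : ℂ) : yfun β m = fun x =>
    (Complex.cos (2 * m * (Real.pi : ℂ)) * jfun β m x - jfun β (-m) x) /
      Complex.sin (2 * m * (Real.pi : ℂ)) := by
  funext x
  simp only [yfun, calY, besselY, jfun, calJ, mul_neg]
  ring

lemma hasDerivAt_jfun (m : ℂ) {β : ℂ} (hβ : β ≠ 0) {x : ℝ} (hx : 0 < x) :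
    HasDerivAt (jfun β m) (((Real.pi : ℂ) ^ ((1 : ℂ) / 2) * β ^ ((1 : ℂ) / 4) * β ^ m) *
      ((x : ℂ) ^ (1 / 2 + m) * ((1 / 2 + m) / x * bessel01 (2 * m + 1) (-β * x)
        - β * bessel01 (2 * m + 2) (-β * x)))) x := by
  have hx' : (x : ℂ) ≠ 0 := by exact_mod_cast hx.ne'
  have h1 : HasDerivAt (fun z : ℂ => z ^ (1 / 2 + m))
      ((1 / 2 + m) * (x : ℂ) ^ (1 / 2 + m - 1)) (x : ℂ) := by
    simpa using (hasDerivAt_id (x : ℂ)).cpow_const (c := 1 / 2 + m)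
      (Complex.ofReal_mem_slitPlane.mpr hx)
  have h2 : HasDerivAt (fun z : ℂ => bessel01 (2 * m + 1) (-β * z))
      (bessel01 (2 * m + 1 + 1) (-β * x) * (-β)) (x : ℂ) :=
    (hasDerivAt_bessel01 (2 * m + 1) (-β * x)).comp (x : ℂ)
      (by simpa only [id, mul_one] using (hasDerivAt_id (x : ℂ)).const_mul (-β))
  have h := ((h1.mul h2).const_mul
    ((Real.pi : ℂ) ^ ((1 : ℂ) / 2) * β ^ ((1 : ℂ) / 4) * β ^ m)).comp_ofReal
  refine (h.congr_deriv ?_).congr_of_eventuallyEq ?_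
  · rw [Complex.cpow_sub _ _ hx', Complex.cpow_one, show 2 * m + 1 + 1 = 2 * m + 2 by ring]
    ring
  · filter_upwards [lt_mem_nhds hx] with t ht
    exact jfun_eq m hβ ht

/-- For `2m ∉ ℤ` and `β ∉ (−∞,0]`, the Wronskian of `j_{β,m}` and `y_{β,m}` equals `√β`
at every point of `(0,∞)`. -/
theorem wronskian_jfun_yfun (m β : ℂ) (hm : ∀ n : ℤ, 2 * m ≠ (n : ℂ))
    (hβ : β ∈ Complex.slitPlane) :
    ∀ x : ℝ, 0 < x →
      jfun β m x * deriv (yfun β m) x - deriv (jfun β m) x * yfun β m x =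
        β ^ ((1 : ℂ) / 2) := by
  intro x hx
  have hβ0 : β ≠ 0 := Complex.slitPlane_ne_zero hβ
  have hx0 : (x : ℂ) ≠ 0 := by exact_mod_cast hx.ne'
  have hπ : (Real.pi : ℂ) ≠ 0 := by exact_mod_cast Real.pi_ne_zero
  have hsin : Complex.sin (2 * m * (Real.pi : ℂ)) ≠ 0 := by
    rw [Complex.sin_ne_zero_iff]
    intro k hk
    exact hm k (mul_right_cancel₀ hπ hk)
  have hj := hasDerivAt_jfun m hβ0 hx
  have hh := hasDerivAt_jfun (-m) hβ0 hx
  have hy := ((hj.const_mul (Complex.cos (2 * m * (Real.pi : ℂ)))).sub hh).div_const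
    (Complex.sin (2 * m * (Real.pi : ℂ)))
  have hdy := hy.deriv
  change deriv (fun x => (Complex.cos (2 * m * (Real.pi : ℂ)) * jfun β m x - jfun β (-m) x) /
    Complex.sin (2 * m * (Real.pi : ℂ))) x = _ at hdy
  rw [← yfun_eq] at hdy
  have hW := bessel01_wronskian (2 * m) (-β * x)
  have hm0 : 2 * m ≠ 0 := by simpa using hm 0
  rw [neg_mul (2 * m), Complex.mul_one_div_Gamma_mul_one_div_Gamma hm0,
    show -(2 * m) = 2 * -m by ring] at hW
  have hxx : (x : ℂ) ^ (1 / 2 + m) * (x : ℂ) ^ (1 / 2 + -m) = x := by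
    rw [← Complex.cpow_add _ _ hx0, show 1 / 2 + m + (1 / 2 + -m) = 1 by ring, Complex.cpow_one]
  have hββ : β ^ m * β ^ (-m) = 1 := by
    rw [← Complex.cpow_add _ _ hβ0, add_neg_cancel, Complex.cpow_zero]
  have hβ4 : β ^ ((1 : ℂ) / 4) * β ^ ((1 : ℂ) / 4) = β ^ ((1 : ℂ) / 2) := by
    rw [← Complex.cpow_add _ _ hβ0]; norm_num
  have hππ : (Real.pi : ℂ) ^ ((1 : ℂ) / 2) * (Real.pi : ℂ) ^ ((1 : ℂ) / 2) = Real.pi := by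
    rw [← Complex.cpow_add _ _ hπ]; norm_num
  rw [hdy, hj.deriv, yfun_eq]
  simp only [jfun_eq _ hβ0 hx]
  generalize bessel01 (2 * m + 1) (-β * x) = P at *
  generalize bessel01 (2 * m + 2) (-β * x) = P' at *
  generalize bessel01 (2 * -m + 1) (-β * x) = Q at *
  generalize bessel01 (2 * -m + 2) (-β * x) = Q' at *
  generalize Complex.sin (2 * m * (Real.pi : ℂ)) = S at *
  generalize (Real.pi : ℂ) ^ ((1 : ℂ) / 2) = p at *
  generalize β ^ ((1 : ℂ) / 4) = q at *
  generalize β ^ ((1 : ℂ) / 2) = r at *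
  generalize β ^ m = u at *
  generalize β ^ (-m) = v at *
  generalize (x : ℂ) ^ (1 / 2 + m) = X at *
  generalize (x : ℂ) ^ (1 / 2 + -m) = Y at *
  calc _ = -((p * p) * (q * q) * (u * v) * (X * Y) *
        ((-β * x) * (P * Q' - P' * Q) - 2 * m * (P * Q))) / (x * S) := by
        field_simp
        ring
    _ = r := by
        rw [hW, hxx, hββ, hβ4, hππ]
        field_simp
end
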